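/- Let P : ℝ^n → Lin(W,X) and Q : ℝ^n → Lin(V,W) be matrix-valued maps all of whose entries are polynomials in ξ ∈ ℝ^n, where V, W, X are finite-dimensional real vector spaces. If ker P(ξ) = im Q(ξ) for all ξ ∈ ℝ^n \ {0}, then both P and Q have constant rank on ℝ^n \ {0}, i.e., there exist r, s ∈ ℕ with rank P(ξ) = r and rank Q(ξ) = s for all ξ ≠ 0. -/

import Mathlib

open scoped BigOperators
open scoped Matrix

theorem Matrix.exists_mul_mul_eq_one_of_rank {K m n : Type*} [Field K] [Fintype m] [Fintype n]
    [DecidableEq m] [DecidableEq n] (M : Matrix m n K) :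
    ∃ (B : Matrix (Fin M.rank) m K) (C : Matrix n (Fin M.rank) K), B * M * C = 1 := by
  obtain ⟨e⟩ : Nonempty (LinearMap.range M.mulVecLin ≃ₗ[K] (Fin M.rank → K)) :=
    ⟨LinearEquiv.ofFinrankEq _ _ (by rw [Module.finrank_fin_fun, Matrix.rank])⟩
  obtain ⟨s, hs⟩ := M.mulVecLin.rangeRestrict.exists_rightInverse_of_surjective
    M.mulVecLin.range_rangeRestrict
  obtain ⟨t, ht⟩ := (LinearMap.range M.mulVecLin).subtype.exists_leftInverse_of_injective
    (Submodule.ker_subtype _)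
  refine ⟨LinearMap.toMatrix' (e.toLinearMap ∘ₗ t),
    LinearMap.toMatrix' (s ∘ₗ e.symm.toLinearMap), ?_⟩
  apply Matrix.toLin'.injective
  simp only [Matrix.toLin'_mul, Matrix.toLin'_toMatrix', Matrix.toLin'_one]
  refine LinearMap.ext fun x => ?_
  have h₁ : M *ᵥ s (e.symm x) = e.symm x :=
    congrArg Subtype.val (LinearMap.congr_fun hs (e.symm x))
  have h₂ : t (e.symm x : m → K) = e.symm x := LinearMap.congr_fun ht (e.symm x)
  simp [h₁, h₂]

/-- Lower semicontinuity of the rank of a polynomial matrix, in the Zariski topology. -/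
theorem Matrix.exists_eval_ne_zero_rank_le {K σ m n : Type*} [Field K] [Fintype m] [Fintype n]
    (A : Matrix m n (MvPolynomial σ K)) (x : σ → K) :
    ∃ f : MvPolynomial σ K, MvPolynomial.eval x f ≠ 0 ∧ ∀ y, MvPolynomial.eval y f ≠ 0 →
      (A.map (MvPolynomial.eval x)).rank ≤ (A.map (MvPolynomial.eval y)).rank := by
  classical
  obtain ⟨B, C, hBC⟩ := (A.map (MvPolynomial.eval x)).exists_mul_mul_eq_one_of_rank
  let B' : Matrix _ m (MvPolynomial σ K) := B.map MvPolynomial.C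
  let C' : Matrix n _ (MvPolynomial σ K) := C.map MvPolynomial.C
  have eval_det (y : σ → K) : MvPolynomial.eval y (B' * A * C').det =
        (B * A.map (MvPolynomial.eval y) * C).det := by
    rw [RingHom.map_det, RingHom.mapMatrix_apply, Matrix.map_mul, Matrix.map_mul]
    congr <;> ext <;> simp [B', C']
  refine ⟨(B' * A * C').det, ?_, fun y hy => ?_⟩
  · rw [eval_det, hBC]
    simp
  · rw [eval_det] at hy
    have h := Matrix.rank_of_isUnit _ ((Matrix.isUnit_iff_isUnit_det _).2 hy.isUnit)
    rw [Fintype.card_fin] at h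
    calc _ = (B * A.map (MvPolynomial.eval y) * C).rank := h.symm
      _ ≤ (B * A.map (MvPolynomial.eval y)).rank := Matrix.rank_mul_le_left _ _
      _ ≤ _ := Matrix.rank_mul_le_right _ _

theorem Matrix.rank_add_rank_of_ker_eq_range {K l m n : Type*} [Field K] [Fintype m] [Fintype n]
    (A : Matrix l m K) (B : Matrix m n K)
    (h : LinearMap.ker A.mulVecLin = LinearMap.range B.mulVecLin) :
    A.rank + B.rank = Fintype.card m := by
  have := A.mulVecLin.finrank_range_add_finrank_ker
  rwa [h, Module.finrank_pi] at this

/-- If `P : ℝ^n → Lin(W, X)` and `Q : ℝ^n → Lin(V, W)` are matrix-valued maps whose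
entries are polynomials in `ξ` (realized here as matrices of multivariate polynomials,
evaluated entrywise, with `V = ℝ^c`, `W = ℝ^b`, `X = ℝ^a`), and
`ker P(ξ) = im Q(ξ)` for all `ξ ≠ 0`, then both `P` and `Q` have constant rank on
`ℝ^n \ {0}`. -/
theorem constant_rank_of_exact_polynomial_pair
    {n a b c : ℕ}
    (P : Matrix (Fin a) (Fin b) (MvPolynomial (Fin n) ℝ))
    (Q : Matrix (Fin b) (Fin c) (MvPolynomial (Fin n) ℝ))
    (hexact : ∀ ξ : Fin n → ℝ, ξ ≠ 0 →
      LinearMap.ker (Matrix.mulVecLin (P.map (MvPolynomial.eval ξ)))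
        = LinearMap.range (Matrix.mulVecLin (Q.map (MvPolynomial.eval ξ)))) :
    ∃ r s : ℕ, ∀ ξ : Fin n → ℝ, ξ ≠ 0 →
      (P.map (MvPolynomial.eval ξ)).rank = r ∧ (Q.map (MvPolynomial.eval ξ)).rank = s := by
  have hsum (ξ : Fin n → ℝ) (hξ : ξ ≠ 0) := Matrix.rank_add_rank_of_ker_eq_range _ _ (hexact ξ hξ)
  have hle (ξ η : Fin n → ℝ) (hξ : ξ ≠ 0) (hη : η ≠ 0) :
      (P.map (MvPolynomial.eval ξ)).rank ≤ (P.map (MvPolynomial.eval η)).rank := by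
    obtain ⟨f, hf, hPf⟩ := P.exists_eval_ne_zero_rank_le ξ
    obtain ⟨g, hg, hQg⟩ := Q.exists_eval_ne_zero_rank_le η
    obtain ⟨i, -⟩ := Function.ne_iff.1 hξ
    have hfg : f * g * MvPolynomial.X i ≠ 0 :=
      mul_ne_zero (mul_ne_zero (by rintro rfl; simp at hf) (by rintro rfl; simp at hg))
        (MvPolynomial.X_ne_zero i)
    obtain ⟨ζ, hζ⟩ : ∃ ζ, MvPolynomial.eval ζ (f * g * MvPolynomial.X i) ≠ 0 := by
      by_contra! h
      exact hfg (MvPolynomial.funext fun ζ => by simpa using h ζ)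
    simp only [map_mul, MvPolynomial.eval_X, mul_ne_zero_iff] at hζ
    obtain ⟨⟨hfζ, hgζ⟩, hiζ⟩ := hζ
    have hζ₀ : ζ ≠ 0 := fun h => hiζ (congrFun h i)
    have := hPf ζ hfζ
    have := hQg ζ hgζ
    have := hsum ζ hζ₀
    have := hsum η hη
    omega
  by_cases h : ∃ ξ₀ : Fin n → ℝ, ξ₀ ≠ 0
  · obtain ⟨ξ₀, h₀⟩ := h
    refine ⟨(P.map (MvPolynomial.eval ξ₀)).rank, (Q.map (MvPolynomial.eval ξ₀)).rank,
      fun ξ hξ => ?_⟩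
    have := hle ξ ξ₀ hξ h₀
    have := hle ξ₀ ξ h₀ hξ
    have := hsum ξ hξ
    have := hsum ξ₀ h₀
    omega
  · exact ⟨0, 0, fun ξ hξ => absurd ⟨ξ, hξ⟩ h⟩
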